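/- arXiv:1902.00834 — 6 statements merged into one kernel-verified Lean document; each statement's English description precedes it below -/
import Mathlib

section
/- For every pair of vectors a, b in P^N (with the same constant total sum c), there exists a unique vector u in P^N such that: (1) a ≺ u and b ≺ u; and (2) for every x in P^N with a ≺ x and b ≺ x, one has u ≺ x. (That is, the majorization order on P^N admits a unique least upper bound a ∨ b.) -/
/-- The nonincreasing rearrangement `a↓` of a vector `a : Fin N → ℝ`. -/
noncomputable def sortDesc {N : ℕ} (a : Fin N → ℝ) : Fin N → ℝ :=
  fun i => a (Tuple.sort a (Fin.rev i))

/-- `pSum a k` is the sum of the `k` largest entries of `a`,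
i.e. `Σ_{i=1}^k a↓_i`. -/
noncomputable def pSum {N : ℕ} (a : Fin N → ℝ) (k : ℕ) : ℝ :=
  ∑ i ∈ Finset.univ.filter (fun i : Fin N => (i : ℕ) < k), sortDesc a i

/-- Majorization `a ≺ b`. -/
noncomputable def Maj {N : ℕ} (a b : Fin N → ℝ) : Prop :=
  (∀ k : ℕ, pSum a k ≤ pSum b k) ∧ (∑ i, a i = ∑ i, b i)

/-- `P^N` with total sum `c`: entries in `[0,1]`, nonincreasing, summing to `c`. -/
def Pset (N : ℕ) (c : ℝ) : Set (Fin N → ℝ) :=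
  {p | (∀ i, 0 ≤ p i ∧ p i ≤ 1) ∧ (∀ i j : Fin N, i ≤ j → p j ≤ p i) ∧ ∑ i, p i = c}

namespace MajJoin

/-- Extension of a vector by zero to all of `ℕ`. -/
noncomputable def ext0 {N : ℕ} (a : Fin N → ℝ) (n : ℕ) : ℝ :=
  if h : n < N then a ⟨n, h⟩ else 0

/-- Partial sums in the given order. -/
noncomputable def S {N : ℕ} (a : Fin N → ℝ) (k : ℕ) : ℝ :=
  ∑ i ∈ Finset.range k, ext0 a i

lemma S_zero {N : ℕ} (a : Fin N → ℝ) : S a 0 = 0 := by simp [S]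

lemma S_succ {N : ℕ} (a : Fin N → ℝ) (k : ℕ) : S a (k + 1) = S a k + ext0 a k := by
  simp [S, Finset.sum_range_succ]

lemma sortDesc_eq {N : ℕ} (a : Fin N → ℝ) (h : ∀ i j : Fin N, i ≤ j → a j ≤ a i) :
    sortDesc a = a := by
  have hm : Monotone (a ∘ (Fin.revPerm : Equiv.Perm (Fin N))) := by
    intro i j hij
    exact h _ _ (Fin.rev_le_rev.mpr hij)
  have h2 := (Tuple.comp_sort_eq_comp_iff_monotone (f := a) (σ := Fin.revPerm)).mpr hm
  funext i
  have h3 := congrFun h2 (Fin.rev i)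
  simpa [sortDesc] using h3.symm

lemma sum_filter_eq {N : ℕ} (a : Fin N → ℝ) (k : ℕ) :
    ∑ i ∈ Finset.univ.filter (fun i : Fin N => (i : ℕ) < k), a i = S a k := by
  induction k with
  | zero => simp [S]
  | succ k ih =>
    rw [S_succ, ← ih]
    unfold ext0
    split_ifs with h
    · have : Finset.univ.filter (fun i : Fin N => (i : ℕ) < k + 1) =
          insert ⟨k, h⟩ (Finset.univ.filter (fun i : Fin N => (i : ℕ) < k)) := by
        ext i
        simp [Fin.ext_iff]
        omega
      rw [this, Finset.sum_insert (by simp), add_comm]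
    · rw [add_zero]
      apply Finset.sum_congr _ (fun _ _ => rfl)
      ext i
      have := i.2
      simp
      omega

lemma pSum_eq {N : ℕ} (a : Fin N → ℝ) (h : ∀ i j : Fin N, i ≤ j → a j ≤ a i) (k : ℕ) :
    pSum a k = S a k := by
  unfold pSum
  rw [sortDesc_eq a h, sum_filter_eq]

lemma S_ge {N : ℕ} (a : Fin N → ℝ) (k : ℕ) (h : N ≤ k) : S a k = ∑ i, a i := by
  rw [← sum_filter_eq]
  apply Finset.sum_congr _ (fun _ _ => rfl)
  ext i
  have := i.2
  simp
  omega

lemma ext0_bd {N : ℕ} {c : ℝ} {a : Fin N → ℝ} (h : a ∈ Pset N c) (k : ℕ) :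
    0 ≤ ext0 a k ∧ ext0 a k ≤ 1 := by
  unfold ext0
  split_ifs
  · exact h.1 _
  · norm_num

lemma ext0_anti {N : ℕ} {c : ℝ} {a : Fin N → ℝ} (h : a ∈ Pset N c) (k : ℕ) :
    ext0 a (k + 1) ≤ ext0 a k := by
  unfold ext0
  split_ifs with h1 h2
  · exact h.2.1 _ _ (by simp [Fin.le_def])
  · omega
  · exact (h.1 _).1
  · exact le_rfl

lemma maj_iff {N : ℕ} {c : ℝ} {a b : Fin N → ℝ} (ha : a ∈ Pset N c) (hb : b ∈ Pset N c) :
    Maj a b ↔ ∀ k, S a k ≤ S b k := by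
  unfold Maj
  rw [ha.2.2, hb.2.2]
  simp [pSum_eq a ha.2.1, pSum_eq b hb.2.1]

lemma S_inj {N : ℕ} {a b : Fin N → ℝ} (h : ∀ k, S a k = S b k) : a = b := by
  funext i
  have h1 := h (i + 1)
  rw [S_succ, S_succ, h i] at h1
  simpa [ext0] using h1

lemma exists_of_concave (N : ℕ) (c : ℝ) (U : ℕ → ℝ) (h0 : U 0 = 0) (hN : ∀ k, N ≤ k → U k = c)
    (hm : ∀ k, U k ≤ U (k + 1)) (h1 : ∀ k, U (k + 1) ≤ U k + 1)
    (hc : ∀ k, k + 1 < N → U k + U (k + 2) ≤ 2 * U (k + 1)) :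
    ∃ u ∈ Pset N c, ∀ k, S u k = U k := by
  have hS : ∀ k, S (fun i : Fin N => U (i + 1) - U i) k = U k := by
    intro k
    induction k with
    | zero => rw [S_zero, h0]
    | succ k ih =>
      rw [S_succ, ih]
      unfold ext0
      split_ifs with h
      · simp
      · rw [hN k (by omega), hN (k + 1) (by omega), add_zero]
  refine ⟨fun i => U (i + 1) - U i, ⟨fun i => ⟨?_, ?_⟩, ?_, ?_⟩, hS⟩
  · have := hm i
    simpa using this
  · have := h1 i
    simp only
    linarith
  · have key : ∀ d i : ℕ, i + d < N → U (i + d + 1) - U (i + d) ≤ U (i + 1) - U i := by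
      intro d
      induction d with
      | zero => intro i _; simp
      | succ d ih =>
        intro i hi
        have := ih i (by omega)
        have h2 := hc (i + d) (by omega)
        have e : i + (d + 1) = i + d + 1 := by omega
        rw [e]
        have e2 : i + d + 1 + 1 = i + d + 2 := by omega
        rw [e2]
        linarith
    intro i j hij
    have hle : (i : ℕ) ≤ j := hij
    have := key (j - i) i (by have := j.2; omega)
    have e : (i : ℕ) + (j - i) = j := by omega
    rw [e] at this
    exact this
  · rw [← S_ge _ N le_rfl, hS, hN N le_rfl]

end MajJoin

open MajJoin in
/-- The majorization order on `P^N` admits a unique least upper bound `a ∨ b`. -/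
theorem majorization_lattice_join (N : ℕ) (c : ℝ) (hc : 0 < c)
    (a b : Fin N → ℝ) (ha : a ∈ Pset N c) (hb : b ∈ Pset N c) :
    ∃! u : Fin N → ℝ, u ∈ Pset N c ∧ Maj a u ∧ Maj b u ∧
      ∀ x ∈ Pset N c, Maj a x → Maj b x → Maj u x := by
  have hle : ∀ x ∈ Pset N c, ∀ k, S x k ≤ k ∧ S x k ≤ c := by
    intro x hx k
    constructor
    · induction k with
      | zero => simp [S_zero]
      | succ k ih =>
        rw [S_succ]
        have := (ext0_bd hx k).2
        push_cast
        linarith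
    · have hmono : Monotone (S x) := monotone_nat_of_le_succ (fun k => by
        rw [S_succ]
        have := (ext0_bd hx k).1
        linarith)
      calc S x k ≤ S x (max k N) := hmono (le_max_left _ _)
        _ = c := by rw [S_ge _ _ (le_max_right _ _), hx.2.2]
  have hcN : c ≤ N := by
    have := (hle a ha N).1
    rwa [S_ge _ _ le_rfl, ha.2.2] at this
  -- an upper bound exists
  obtain ⟨t, ht, htS⟩ := exists_of_concave N c (fun k => min (k : ℝ) c) (by simp [hc.le])
    (fun k hk => min_eq_right (hcN.trans (by exact_mod_cast hk)))
    (fun k => by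
      apply min_le_min_right
      push_cast
      linarith)
    (fun k => by
      push_cast
      rcases min_choice (k : ℝ) c with h | h <;> rw [h]
      · exact min_le_left _ _
      · exact (min_le_right _ _).trans (by linarith))
    (fun k _ => by
      push_cast
      have h1 := min_le_left (k : ℝ) c
      have h2 := min_le_right (k : ℝ) c
      have h3 := min_le_left ((k : ℝ) + 2) c
      have h4 := min_le_right ((k : ℝ) + 2) c
      rcases min_choice ((k : ℝ) + 1) c with h | h <;> rw [h] <;> linarith)
  let X := {x : Fin N → ℝ // x ∈ Pset N c ∧ (∀ k, S a k ≤ S x k) ∧ (∀ k, S b k ≤ S x k)}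
  have : Nonempty X := ⟨⟨t, ht, fun k => by rw [htS]; exact le_min (hle a ha k).1 (hle a ha k).2,
    fun k => by rw [htS]; exact le_min (hle b hb k).1 (hle b hb k).2⟩⟩
  let U : ℕ → ℝ := fun k => ⨅ x : X, S x.1 k
  have hbdd : ∀ k, BddBelow (Set.range fun x : X => S x.1 k) := by
    intro k
    refine ⟨S a k, ?_⟩
    rintro _ ⟨x, rfl⟩
    exact x.2.2.1 k
  have hU : ∀ k (x : X), U k ≤ S x.1 k := fun k x => ciInf_le (hbdd k) x
  have hUg : ∀ k r, (∀ x : X, r ≤ S x.1 k) → r ≤ U k := fun k r h => le_ciInf h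
  obtain ⟨u, hu, huS⟩ := exists_of_concave N c U (by simp [U, S_zero])
    (fun k hk => by
      have : ∀ x : X, S x.1 k = c := fun x => by rw [S_ge _ _ hk, x.2.1.2.2]
      simp [U, this])
    (fun k => hUg _ _ fun x => by
      have h1 := hU k x
      have h2 := (ext0_bd x.2.1 k).1
      rw [S_succ]
      linarith)
    (fun k => by
      have : U (k + 1) - 1 ≤ U k := hUg _ _ fun x => by
        have h1 := hU (k + 1) x
        have h2 := (ext0_bd x.2.1 k).2
        rw [S_succ] at h1
        linarith
      linarith)
    (fun k _ => by
      have : (U k + U (k + 2)) / 2 ≤ U (k + 1) := hUg _ _ fun x => by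
        have h1 := hU k x
        have h2 := hU (k + 2) x
        have h3 := ext0_anti x.2.1 k
        rw [S_succ, S_succ] at h2
        rw [S_succ]
        linarith
      linarith)
  have hau : Maj a u := (maj_iff ha hu).2 fun k => by
    rw [huS]; exact hUg _ _ fun x => x.2.2.1 k
  have hbu : Maj b u := (maj_iff hb hu).2 fun k => by
    rw [huS]; exact hUg _ _ fun x => x.2.2.2 k
  have hmin : ∀ x ∈ Pset N c, Maj a x → Maj b x → Maj u x := fun x hx hax hbx =>
    (maj_iff hu hx).2 fun k => by
      rw [huS]
      exact hU k ⟨x, hx, (maj_iff ha hx).1 hax, (maj_iff hb hx).1 hbx⟩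
  refine ⟨u, ⟨hu, hau, hbu, hmin⟩, ?_⟩
  rintro v ⟨hv, hav, hbv, hvmin⟩
  apply S_inj
  intro k
  exact le_antisymm ((maj_iff hv hu).1 (hvmin u hu hau hbu) k)
    ((maj_iff hu hv).1 (hmin v hv hav hbv) k)
end

section
/- For every pair of vectors a, b in P^N (with the same constant total sum c), there exists a unique vector w in P^N such that: (1) w ≺ a and w ≺ b; and (2) for every x in P^N with x ≺ a and x ≺ b, one has x ≺ w. (That is, the majorization order on P^N admits a unique greatest lower bound a ∧ b.) -/
theorem sortDesc_of_anti {N : ℕ} (a : Fin N → ℝ) (h : ∀ i j : Fin N, i ≤ j → a j ≤ a i) :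
    sortDesc a = a := by
  funext i
  have h1 : Monotone (a ∘ Tuple.sort a) := Tuple.monotone_sort a
  have h2 : Monotone (a ∘ (Fin.revPerm : Equiv.Perm (Fin N))) := by
    intro i j hij
    exact h _ _ (by simpa using hij)
  have h3 := congrFun (Tuple.unique_monotone h1 h2) (Fin.rev i)
  simpa [sortDesc] using h3

/-- Extension by zero. -/
noncomputable def extz {N : ℕ} (a : Fin N → ℝ) (n : ℕ) : ℝ := if h : n < N then a ⟨n, h⟩ else 0

/-- Partial sums. -/
noncomputable def psm {N : ℕ} (a : Fin N → ℝ) (k : ℕ) : ℝ := ∑ i ∈ Finset.range k, extz a i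

theorem psm_succ {N : ℕ} (a : Fin N → ℝ) (k : ℕ) : psm a (k + 1) = psm a k + extz a k :=
  Finset.sum_range_succ _ _

theorem filter_sum_eq_psm {N : ℕ} (a : Fin N → ℝ) (k : ℕ) :
    ∑ i ∈ Finset.univ.filter (fun i : Fin N => (i : ℕ) < k), a i = psm a k := by
  induction k with
  | zero => simp [psm]
  | succ k ih =>
    rw [psm_succ, ← ih, extz]
    split_ifs with h
    · have : Finset.univ.filter (fun i : Fin N => (i : ℕ) < k + 1)
          = insert ⟨k, h⟩ (Finset.univ.filter (fun i : Fin N => (i : ℕ) < k)) := by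
        ext i
        simp only [Finset.mem_filter, Finset.mem_univ, true_and, Finset.mem_insert, Fin.ext_iff]
        omega
      rw [this, Finset.sum_insert (by simp), add_comm]
    · rw [add_zero]
      congr 1
      ext i
      have := i.2
      simp only [Finset.mem_filter, Finset.mem_univ, true_and]
      omega

theorem pSum_eq {N : ℕ} (a : Fin N → ℝ) (h : ∀ i j : Fin N, i ≤ j → a j ≤ a i) (k : ℕ) :
    pSum a k = psm a k := by
  rw [pSum, sortDesc_of_anti a h, filter_sum_eq_psm]

theorem psm_total {N : ℕ} (a : Fin N → ℝ) (k : ℕ) (hk : N ≤ k) : psm a k = ∑ i, a i := by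
  rw [← filter_sum_eq_psm, Finset.filter_true_of_mem]
  intro i _
  exact i.2.trans_le hk

theorem extz_bd {N : ℕ} {c : ℝ} {a : Fin N → ℝ} (ha : a ∈ Pset N c) (n : ℕ) :
    0 ≤ extz a n ∧ extz a n ≤ 1 := by
  unfold extz
  split_ifs
  · exact ha.1 _
  · norm_num

theorem extz_anti {N : ℕ} {c : ℝ} {a : Fin N → ℝ} (ha : a ∈ Pset N c) (n : ℕ) :
    extz a (n + 1) ≤ extz a n := by
  by_cases h : n + 1 < N
  · have h' : n < N := by omega
    simp only [extz, h, h', dif_pos]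
    exact ha.2.1 _ _ (by simp [Fin.le_def])
  · have : extz a (n + 1) = 0 := by simp [extz, h]
    rw [this]
    exact (extz_bd ha n).1

/-- The meet. -/
noncomputable def meetv {N : ℕ} (a b : Fin N → ℝ) (i : Fin N) : ℝ :=
  min (psm a (i + 1)) (psm b (i + 1)) - min (psm a i) (psm b i)

theorem psm_meetv {N : ℕ} {c : ℝ} {a b : Fin N → ℝ} (ha : a ∈ Pset N c) (hb : b ∈ Pset N c)
    (k : ℕ) : psm (meetv a b) k = min (psm a k) (psm b k) := by
  induction k with
  | zero => simp [psm]
  | succ k ih =>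
    rw [psm_succ, ih]
    by_cases h : k < N
    · simp [extz, h, meetv]
    · have e : ∀ x : Fin N → ℝ, extz x k = 0 := fun x => by simp [extz, h]
      simp [psm_succ, e]

theorem meetv_mem {N : ℕ} {c : ℝ} {a b : Fin N → ℝ} (ha : a ∈ Pset N c) (hb : b ∈ Pset N c) :
    meetv a b ∈ Pset N c := by
  refine ⟨fun i => ?_, ?_, ?_⟩
  · have h1 := extz_bd ha i
    have h2 := extz_bd hb i
    simp only [meetv, psm_succ]
    constructor <;> rcases min_cases (psm a i + extz a i) (psm b i + extz b i) with h | h <;>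
      rcases min_cases (psm a i) (psm b i) with h' | h' <;> linarith
  · have key : Antitone (fun n : ℕ =>
        min (psm a (n + 1)) (psm b (n + 1)) - min (psm a n) (psm b n)) := by
      apply antitone_nat_of_succ_le
      intro n
      have h1 := extz_anti ha n
      have h2 := extz_anti hb n
      have a1 := psm_succ a n
      have a2 := psm_succ a (n + 1)
      have b1 := psm_succ b n
      have b2 := psm_succ b (n + 1)
      have m1 := min_le_left (psm a (n + 1 + 1)) (psm b (n + 1 + 1))
      have m2 := min_le_right (psm a (n + 1 + 1)) (psm b (n + 1 + 1))
      have m3 := min_le_left (psm a n) (psm b n)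
      have m4 := min_le_right (psm a n) (psm b n)
      rcases min_cases (psm a (n + 1)) (psm b (n + 1)) with h | h <;> linarith
    intro i j hij
    exact key (show (i : ℕ) ≤ j from hij)
  · rw [← psm_total _ N le_rfl, psm_meetv ha hb, psm_total _ N le_rfl, psm_total _ N le_rfl,
      ha.2.2, hb.2.2, min_self]

theorem maj_iff {N : ℕ} {c : ℝ} {a b : Fin N → ℝ} (ha : a ∈ Pset N c) (hb : b ∈ Pset N c) :
    Maj a b ↔ ∀ k, psm a k ≤ psm b k := by
  simp only [Maj, pSum_eq a ha.2.1, pSum_eq b hb.2.1, ha.2.2, hb.2.2, and_true]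

theorem eq_of_maj {N : ℕ} {c : ℝ} {a b : Fin N → ℝ} (ha : a ∈ Pset N c) (hb : b ∈ Pset N c)
    (h1 : Maj a b) (h2 : Maj b a) : a = b := by
  rw [maj_iff ha hb] at h1
  rw [maj_iff hb ha] at h2
  have e : ∀ k, psm a k = psm b k := fun k => le_antisymm (h1 k) (h2 k)
  funext i
  have h3 := e (i + 1)
  rw [psm_succ, psm_succ, e i] at h3
  simpa [extz] using h3

/-- The majorization order on `P^N` admits a unique greatest lower bound `a ∧ b`. -/
theorem majorization_lattice_meet (N : ℕ) (c : ℝ) (hc : 0 < c)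
    (a b : Fin N → ℝ) (ha : a ∈ Pset N c) (hb : b ∈ Pset N c) :
    ∃! w : Fin N → ℝ, w ∈ Pset N c ∧ Maj w a ∧ Maj w b ∧
      ∀ x ∈ Pset N c, Maj x a → Maj x b → Maj x w := by
  have hm := meetv_mem ha hb
  have p1 : Maj (meetv a b) a := (maj_iff hm ha).2 fun k => by
    rw [psm_meetv ha hb]; exact min_le_left _ _
  have p2 : Maj (meetv a b) b := (maj_iff hm hb).2 fun k => by
    rw [psm_meetv ha hb]; exact min_le_right _ _
  have p3 : ∀ x ∈ Pset N c, Maj x a → Maj x b → Maj x (meetv a b) := by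
    intro x hx h1 h2
    refine (maj_iff hx hm).2 fun k => ?_
    rw [psm_meetv ha hb]
    exact le_min ((maj_iff hx ha).1 h1 k) ((maj_iff hx hb).1 h2 k)
  refine ⟨meetv a b, ⟨hm, p1, p2, p3⟩, ?_⟩
  rintro w ⟨hw, q1, q2, q3⟩
  exact eq_of_maj hw hm (p3 w hw q1 q2) (q3 _ hm p1 p2)
end

section
/- Let S be a nonempty subset of P^N, and suppose that for each n ∈ {1,…,N} there exists s^(n) ∈ S such that Σ_{i=1}^n s^(n)_i ≥ Σ_{i=1}^n v_i for every v ∈ S. Set s := s^(1) ∨ s^(2) ∨ … ∨ s^(N) (the iterated join, unambiguous by associativity of ∨). Then: (i) v ≺ s for every v ∈ S; and (ii) for every t ∈ P^N such that v ≺ t for all v ∈ S, one has s ≺ t. That is, s is the least upper bound of the set S in the majorization lattice (P^N, ≺). -/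
/-- Least upper bound of a set `S ⊆ P^N` from partial-sum maximizers:
if for each `n ∈ {1,…,N}` the vector `sv n ∈ S` has the largest sum of its first
`n` components among all members of `S`, then the iterated join
`s = sv 1 ∨ sv 2 ∨ ⋯ ∨ sv N` is the least upper bound of `S` in `(P^N, ≺)`. -/
theorem lub_of_partial_sum_maximizers (N : ℕ) (hN : 0 < N) (c : ℝ) (hc : 0 < c)
    (join : (Fin N → ℝ) → (Fin N → ℝ) → (Fin N → ℝ))
    (hjoin : ∀ p ∈ Pset N c, ∀ q ∈ Pset N c,
      join p q ∈ Pset N c ∧ Maj p (join p q) ∧ Maj q (join p q) ∧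
        ∀ t ∈ Pset N c, Maj p t → Maj q t → Maj (join p q) t)
    (S : Set (Fin N → ℝ)) (hSne : S.Nonempty) (hSP : S ⊆ Pset N c)
    (sv : ℕ → (Fin N → ℝ))
    (hsv : ∀ n, 1 ≤ n → n ≤ N →
      sv n ∈ S ∧ ∀ v ∈ S, pSum v n ≤ pSum (sv n) n) :
    let s := (List.range (N - 1)).foldl (fun acc k => join acc (sv (k + 2))) (sv 1)
    (∀ v ∈ S, Maj v s) ∧ ∀ t ∈ Pset N c, (∀ v ∈ S, Maj v t) → Maj s t := by
  intro s
  have key : ∀ m : ℕ, m + 1 ≤ N →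
      (List.range m).foldl (fun acc k => join acc (sv (k + 2))) (sv 1) ∈ Pset N c ∧
      (∀ n, 1 ≤ n → n ≤ m + 1 →
        Maj (sv n) ((List.range m).foldl (fun acc k => join acc (sv (k + 2))) (sv 1))) ∧
      (∀ t ∈ Pset N c, (∀ v ∈ S, Maj v t) →
        Maj ((List.range m).foldl (fun acc k => join acc (sv (k + 2))) (sv 1)) t) := by
    intro m
    induction m with
    | zero =>
      intro hm
      have h1 := (hsv 1 le_rfl hm).1
      refine ⟨hSP h1, ?_, fun t _ h => h _ h1⟩
      intro n hn hn'
      obtain rfl : n = 1 := by omega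
      exact ⟨fun k => le_rfl, rfl⟩
    | succ m ih =>
      intro hm
      obtain ⟨hP, hub, hle⟩ := ih (by omega)
      have h2 := (hsv (m + 2) (by omega) hm).1
      rw [List.range_succ, List.foldl_append]
      simp only [List.foldl_cons, List.foldl_nil]
      obtain ⟨jP, j1, j2, j3⟩ := hjoin _ hP _ (hSP h2)
      refine ⟨jP, ?_, fun t ht h => j3 t ht (hle t ht h) (h _ h2)⟩
      intro n hn hn'
      rcases Nat.lt_or_ge n (m + 2) with h | h
      · have h3 := hub n hn (by omega)
        exact ⟨fun k => (h3.1 k).trans (j1.1 k), h3.2.trans j1.2⟩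
      · obtain rfl : n = m + 2 := by omega
        exact j2
  obtain ⟨hP, hub, hle⟩ := key (N - 1) (by omega)
  refine ⟨fun v hv => ⟨?_, (hSP hv).2.2.trans hP.2.2.symm⟩, hle⟩
  have main : ∀ k, 1 ≤ k → k ≤ N → pSum v k ≤ pSum s k := fun k h1 h2 =>
    ((hsv k h1 h2).2 v hv).trans ((hub k h1 (by omega)).1 k)
  intro k
  rcases Nat.eq_zero_or_pos k with rfl | hk
  · simp [pSum]
  · rcases le_total k N with h | h
    · exact main k hk h
    · have e : ∀ a : Fin N → ℝ, pSum a k = pSum a N := by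
        intro a
        unfold pSum
        congr 1
        ext i
        have := i.2
        simp only [Finset.mem_filter, Finset.mem_univ, true_and]
        omega
      rw [e, e]
      exact main N hN le_rfl
end

section
/- Let χ, s ∈ ℝ^K be nonnegative vectors with χ ≺ s. Then s↓_j = 0 whenever χ↓_j = 0 (so the relative entropy D(s↓‖χ↓) := Σ_j s↓_j log(s↓_j/χ↓_j) is well defined and finite, with the convention 0·log(0/x) = 0), and moreover H(χ) ≥ H(s) + D(s↓‖χ↓) with D(s↓‖χ↓) ≥ 0. In particular, for probability vectors p^(1),…,p^(M) with χ = p^(1) ⊕ … ⊕ p^(M) ≺ s, one has Σ_{j=1}^M H(p^(j)) ≥ H(s) + D(s↓‖χ↓). -/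
/-- Shannon entropy `H(p) = −Σ_i p_i log p_i` (with `0 log 0 = 0`). -/
noncomputable def shannonH {N : ℕ} (p : Fin N → ℝ) : ℝ :=
  -∑ i, p i * Real.log (p i)

/-- Relative entropy `D(s↓ ‖ χ↓) = Σ_j s↓_j log (s↓_j / χ↓_j)`, with the
convention `0 · log (0 / x) = 0`. -/
noncomputable def relEnt {K : ℕ} (s χ : Fin K → ℝ) : ℝ :=
  ∑ j, if sortDesc s j = 0 then 0
    else sortDesc s j * Real.log (sortDesc s j / sortDesc χ j)

lemma abel_aux : ∀ (K : ℕ) (d g : Fin K → ℝ) (c : ℝ), Antitone g → (∀ i, c ≤ g i) →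
    (∀ k : ℕ, 0 ≤ ∑ i : Fin K, if (i : ℕ) < k then d i else 0) → c * ∑ i, d i ≤ ∑ i, d i * g i := by
  intro K
  induction K with
  | zero => intro d g c _ _ _; simp
  | succ K ih =>
    intro d g c hg hc hd
    have h1 := ih (fun i => d i.castSucc) (fun i => g i.castSucc) (g (Fin.last K))
      (fun i j hij => hg (Fin.castSucc_le_castSucc_iff.2 hij)) (fun i => hg (Fin.le_last _))
      (by
        intro k
        have h := hd (min k K)
        rw [Fin.sum_univ_castSucc] at h
        simpa using h)
    have h2 := hd (K + 1)
    have h3 : (∑ i : Fin (K+1), if (i : ℕ) < K + 1 then d i else 0) = ∑ i, d i :=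
      Finset.sum_congr rfl (fun i _ => if_pos i.2)
    rw [h3] at h2
    have h4 := mul_le_mul_of_nonneg_right (hc (Fin.last K)) h2
    refine h4.trans ?_
    rw [Fin.sum_univ_castSucc, Fin.sum_univ_castSucc]
    nlinarith

lemma sortDesc_antitone {N : ℕ} (a : Fin N → ℝ) : Antitone (sortDesc a) := by
  intro i j hij
  exact Tuple.monotone_sort a (Fin.rev_le_rev.2 hij)

lemma sortDesc_sum {N : ℕ} (a : Fin N → ℝ) (f : ℝ → ℝ) :
    ∑ i, f (sortDesc a i) = ∑ i, f (a i) :=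
  Equiv.sum_comp (Fin.revPerm.trans (Tuple.sort a)) (fun i => f (a i))

lemma core {K : ℕ} (x y : Fin K → ℝ) (hx : Antitone x)
    (hx0 : ∀ i, 0 ≤ x i) (hy0 : ∀ i, 0 ≤ y i)
    (hp : ∀ k : ℕ, (∑ i : Fin K, if (i : ℕ) < k then x i else 0) ≤ ∑ i : Fin K, if (i : ℕ) < k then y i else 0)
    (ht : ∑ i, x i = ∑ i, y i) :
    (∀ j, x j = 0 → y j = 0) ∧
    0 ≤ (∑ j, if y j = 0 then 0 else y j * Real.log (y j / x j)) ∧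
    -(∑ j, y j * Real.log (y j)) + (∑ j, if y j = 0 then 0 else y j * Real.log (y j / x j))
      ≤ -(∑ j, x j * Real.log (x j)) := by
  have hz : ∀ j, x j = 0 → y j = 0 := by
    intro j hj
    have h1 : (∑ i : Fin K, if (i : ℕ) < (j : ℕ) then x i else 0) = ∑ i, x i := by
      refine Finset.sum_congr rfl fun i _ => ?_
      split_ifs with h
      · rfl
      · have := hx (show j ≤ i from not_lt.1 h)
        linarith [hx0 i]
    have h2 := hp j
    rw [h1, ht] at h2
    have h3 : (∑ i : Fin K, (y i - if (i : ℕ) < (j : ℕ) then y i else 0)) ≤ 0 := by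
      rw [Finset.sum_sub_distrib]; linarith
    have h4 := Finset.single_le_sum
      (f := fun i : Fin K => y i - if (i : ℕ) < (j : ℕ) then y i else 0)
      (fun i _ => by split_ifs <;> simp [hy0 i]) (Finset.mem_univ j)
    simp only [lt_irrefl, if_false] at h4
    linarith [hy0 j]
  refine ⟨hz, ?_, ?_⟩
  · have h : ∑ j, (y j - x j) ≤ ∑ j, if y j = 0 then 0 else y j * Real.log (y j / x j) := by
      refine Finset.sum_le_sum fun j _ => ?_
      split_ifs with h
      · linarith [hx0 j]
      · have hy : 0 < y j := lt_of_le_of_ne (hy0 j) (Ne.symm h)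
        have hxp : 0 < x j := lt_of_le_of_ne (hx0 j) (fun e => h (hz j e.symm))
        have h1 := Real.log_le_sub_one_of_pos (div_pos hxp hy)
        have h2 : Real.log (y j / x j) = - Real.log (x j / y j) := by
          rw [← Real.log_inv, inv_div]
        have h3 := mul_le_mul_of_nonneg_left h1 hy.le
        have h4 : y j * (x j / y j - 1) = x j - y j := by field_simp
        rw [h2]; linarith
    rw [Finset.sum_sub_distrib, ht, sub_self] at h
    exact h
  · let L : ℝ := -∑ i, |Real.log (x i)|
    have hL : ∀ i, L ≤ Real.log (x i) := by
      intro i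
      have := Finset.single_le_sum (f := fun i => |Real.log (x i)|)
        (fun i _ => abs_nonneg _) (Finset.mem_univ i)
      have h2 := neg_abs_le (Real.log (x i))
      simp only [L]; linarith
    let g : Fin K → ℝ := fun i => if x i = 0 then L else Real.log (x i)
    have hgL : ∀ i, L ≤ g i := by
      intro i
      by_cases h : x i = 0
      · simp [g, h]
      · simp only [g, h, if_false]; exact hL i
    have hg : Antitone g := by
      intro i j hij
      by_cases h : x j = 0
      · have : g j = L := by simp [g, h]
        rw [this]; exact hgL i
      · have hj : 0 < x j := lt_of_le_of_ne (hx0 j) (Ne.symm h)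
        have hi : x j ≤ x i := hx hij
        have hi0 : x i ≠ 0 := (lt_of_lt_of_le hj hi).ne'
        simp only [g, h, hi0, if_false]
        exact Real.log_le_log hj hi
    have key := abel_aux K (fun i => y i - x i) g L hg hgL (by
      intro k
      have := hp k
      rw [← sub_nonneg, ← Finset.sum_sub_distrib] at this
      refine this.trans_eq (Finset.sum_congr rfl fun i _ => ?_)
      split_ifs <;> simp)
    rw [Finset.sum_sub_distrib, ht, sub_self, mul_zero] at key
    have h5 : ∑ i, (y i - x i) * g i = ∑ j, (y j * Real.log (y j)
        - (if y j = 0 then 0 else y j * Real.log (y j / x j)) - x j * Real.log (x j)) := by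
      refine Finset.sum_congr rfl fun j _ => ?_
      by_cases h : x j = 0
      · simp [h, hz j h]
      · simp only [g, h, if_false]
        split_ifs with hy
        · simp [hy]
        · rw [Real.log_div hy h]; ring
    rw [h5, Finset.sum_sub_distrib, Finset.sum_sub_distrib] at key
    linarith

/-- Improved entropic uncertainty relation: if `χ ≺ s` (nonnegative vectors), then
`s↓_j = 0` whenever `χ↓_j = 0` (hence `D(s↓‖χ↓)` is well defined and finite),
`D(s↓‖χ↓) ≥ 0`, and `H(χ) ≥ H(s) + D(s↓‖χ↓)`.  In particular, for probability
vectors `p⁽¹⁾,…,p⁽ᴹ⁾` whose concatenation is `χ`, one has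
`Σ_j H(p⁽ʲ⁾) ≥ H(s) + D(s↓‖χ↓)`. -/
theorem entropic_uncertainty_improved (K : ℕ) (χ s : Fin K → ℝ)
    (hχ0 : ∀ k, 0 ≤ χ k) (hs0 : ∀ k, 0 ≤ s k) (hmaj : Maj χ s) :
    (∀ j, sortDesc χ j = 0 → sortDesc s j = 0) ∧
    0 ≤ relEnt s χ ∧
    shannonH χ ≥ shannonH s + relEnt s χ ∧
    ∀ (M N : ℕ) (p : Fin M → Fin N → ℝ) (hK : M * N = K),
      (∀ j i, 0 ≤ p j i) → (∀ j, ∑ i, p j i = 1) →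
      (∀ k : Fin (M * N),
        χ (Fin.cast hK k) = p (finProdFinEquiv.symm k).1 (finProdFinEquiv.symm k).2) →
      ∑ j, shannonH (p j) ≥ shannonH s + relEnt s χ := by
  have hx0 : ∀ i, 0 ≤ sortDesc χ i := fun i => hχ0 _
  have hy0 : ∀ i, 0 ≤ sortDesc s i := fun i => hs0 _
  obtain ⟨h1, h2, h3⟩ := core (sortDesc χ) (sortDesc s) (sortDesc_antitone χ) hx0 hy0
    (fun k => by
      have := hmaj.1 k
      simpa only [pSum, Finset.sum_filter] using this)
    (by rw [sortDesc_sum χ (fun t => t), sortDesc_sum s (fun t => t)]; exact hmaj.2)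
  rw [sortDesc_sum χ (fun t => t * Real.log t), sortDesc_sum s (fun t => t * Real.log t)] at h3
  refine ⟨h1, h2, h3, ?_⟩
  intro M N p hK _ _ hp
  subst hK
  have h4 : ∑ j, shannonH (p j) = shannonH χ := by
    simp only [shannonH, Finset.sum_neg_distrib]
    rw [← Fintype.sum_prod_type' (fun j i => p j i * Real.log (p j i)),
      ← Equiv.sum_comp finProdFinEquiv.symm]
    congr 1
    refine Finset.sum_congr rfl fun k _ => ?_
    have := hp k
    simp only [Fin.cast_eq_self] at this
    rw [this]
  rw [h4]; exact h3
end

section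
/- The function d(p, q) := H(p) + H(q) − 2·H(p ∨ q) is a metric on P^N: for all p, q, r ∈ P^N (same constant total sum), d(p, q) ≥ 0; d(p, q) = 0 if and only if p = q; d(p, q) = d(q, p); and d(p, r) ≤ d(p, q) + d(q, r). -/
section
open Finset

/-- partial sums -/
def PS (x : ℕ → ℝ) (k : ℕ) : ℝ := ∑ i ∈ range k, x i

lemma PS_succ (x : ℕ → ℝ) (k : ℕ) : PS x (k+1) = PS x k + x k := by
  simp [PS, sum_range_succ]

lemma PS_zero (x : ℕ → ℝ) : PS x 0 = 0 := by simp [PS]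

lemma negMulLog_tangent {s w : ℝ} (hs : 0 < s) (hw : 0 ≤ w) :
    Real.negMulLog w ≤ Real.negMulLog s + (-Real.log s - 1) * (w - s) ∧
    (Real.negMulLog w = Real.negMulLog s + (-Real.log s - 1) * (w - s) → w = s) := by
  rcases hw.eq_or_lt with rfl | hw
  · simp only [Real.negMulLog, Real.log_zero]
    constructor
    · nlinarith
    · intro h; nlinarith
  · have hl : Real.log (s / w) = Real.log s - Real.log w := Real.log_div hs.ne' hw.ne'
    have e : w * (s / w) = s := by field_simp
    have h1 := Real.log_le_sub_one_of_pos (div_pos hs hw)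
    have h2 := mul_le_mul_of_nonneg_left h1 hw.le
    simp only [Real.negMulLog]
    constructor
    · rw [hl] at h2; nlinarith
    · intro h
      by_contra hne
      have hne' : s / w ≠ 1 := by
        intro h'; rw [h'] at e; apply hne; linarith
      have h3 := Real.log_lt_sub_one_of_pos (div_pos hs hw) hne'
      have h4 := mul_lt_mul_of_pos_left h3 hw
      rw [hl] at h4; nlinarith

lemma key (N : ℕ) (x y : ℕ → ℝ) (hx : ∀ i, 0 ≤ x i) (hy : ∀ i, 0 ≤ y i)
    (h0 : ∀ i, x i = 0 → y i = 0) (hN : PS x N = PS y N)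
    (hD : ∀ i, 0 ≤ (Real.log (x i) - Real.log (x (i+1))) * (PS y (i+1) - PS x (i+1))) :
    PS (fun i => Real.negMulLog (y i)) N ≤ PS (fun i => Real.negMulLog (x i)) N ∧
    (PS (fun i => Real.negMulLog (y i)) N = PS (fun i => Real.negMulLog (x i)) N →
      ∀ i < N, y i = x i) := by
  have habel : ∀ n, Real.log (x n) * (PS y (n+1) - PS x (n+1)) ≤
      PS (fun i => Real.log (x i) * (y i - x i)) (n+1) := by
    intro n
    induction n with
    | zero => simp [PS]
    | succ n ih =>
      rw [PS_succ y (n+1), PS_succ x (n+1), PS_succ _ (n+1)]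
      have := hD n
      nlinarith
  have hL : 0 ≤ PS (fun i => Real.log (x i) * (y i - x i)) N := by
    cases N with
    | zero => simp [PS]
    | succ n => have := habel n; rw [hN] at this; simpa using this
  have hpt : ∀ i, Real.negMulLog (y i) ≤
      Real.negMulLog (x i) + (-Real.log (x i) - 1) * (y i - x i) ∧
      (Real.negMulLog (y i) = Real.negMulLog (x i) + (-Real.log (x i) - 1) * (y i - x i)
        → y i = x i) := by
    intro i
    rcases (hx i).eq_or_lt with h | h
    · have := h0 i h.symm
      rw [← h, this]; simp
    · exact negMulLog_tangent h (hy i)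
  have hsum : PS (fun i => Real.negMulLog (x i) + (-Real.log (x i) - 1) * (y i - x i)) N
      = PS (fun i => Real.negMulLog (x i)) N
        - PS (fun i => Real.log (x i) * (y i - x i)) N - (PS y N - PS x N) := by
    simp only [PS, ← sum_sub_distrib]
    refine sum_congr rfl fun i _ => by ring
  have hle : PS (fun i => Real.negMulLog (y i)) N ≤
      PS (fun i => Real.negMulLog (x i) + (-Real.log (x i) - 1) * (y i - x i)) N :=
    sum_le_sum fun i _ => (hpt i).1
  refine ⟨by rw [hsum, hN] at hle; linarith, fun he i hi => ?_⟩
  have heq : PS (fun i => Real.negMulLog (y i)) N =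
      PS (fun i => Real.negMulLog (x i) + (-Real.log (x i) - 1) * (y i - x i)) N :=
    le_antisymm hle (by rw [hsum, hN, he]; linarith)
  exact (hpt i).2 ((sum_eq_sum_iff_of_le fun i _ => (hpt i).1).1 heq i (mem_range.2 hi))

structure Good (N : ℕ) (c : ℝ) (x : ℕ → ℝ) : Prop where
  nonneg : ∀ i, 0 ≤ x i
  anti : Antitone x
  zero : ∀ i, N ≤ i → x i = 0
  sum : PS x N = c

lemma PS_mono {x : ℕ → ℝ} (hx : ∀ i, 0 ≤ x i) : Monotone (PS x) :=
  monotone_nat_of_le_succ fun n => by rw [PS_succ]; linarith [hx n]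

lemma PS_const {x : ℕ → ℝ} {k : ℕ} (h : ∀ i, k ≤ i → x i = 0) :
    ∀ n, k ≤ n → PS x n = PS x k := by
  intro n hn
  induction n, hn using Nat.le_induction with
  | base => rfl
  | succ n hn ih => rw [PS_succ, ih, h n hn, add_zero]

lemma Good.PS_ge {N c x} (h : Good N c x) {k} (hk : N ≤ k) : PS x k = c := by
  rw [PS_const h.zero k hk, h.sum]

lemma Good.PS_le {N c x} (h : Good N c x) (k) : PS x k ≤ c := by
  rw [← h.PS_ge (le_max_left N k)]
  exact PS_mono h.nonneg (le_max_right _ _)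

lemma Good.PS_of_zero {N c x} (h : Good N c x) {k} (hk : x k = 0) : PS x k = c := by
  rw [← h.PS_ge (le_max_left N k)]
  refine (PS_const (fun i hi => ?_) _ (le_max_right _ _)).symm
  exact le_antisymm (hk ▸ h.anti hi) (h.nonneg i)

lemma eq_zero_of_PS {y : ℕ → ℝ} {c : ℝ} (hy : ∀ i, 0 ≤ y i) (hle : ∀ k, PS y k ≤ c) {k : ℕ}
    (h : PS y k = c) : y k = 0 := by
  have := hle (k+1)
  rw [PS_succ] at this
  linarith [hy k]

lemma schur {N c} {x y : ℕ → ℝ} (hx : Good N c x) (hy : ∀ i, 0 ≤ y i)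
    (hle : ∀ k, PS y k ≤ c) (hxy : ∀ k, PS x k ≤ PS y k) :
    PS (fun i => Real.negMulLog (y i)) N ≤ PS (fun i => Real.negMulLog (x i)) N ∧
    (PS (fun i => Real.negMulLog (y i)) N = PS (fun i => Real.negMulLog (x i)) N →
      ∀ i < N, y i = x i) := by
  have hc : ∀ k, PS x k = c → PS y k = c := fun k h => le_antisymm (hle k) (h ▸ hxy k)
  refine key N x y hx.nonneg hy (fun i h => ?_) ?_ (fun i => ?_)
  · exact eq_zero_of_PS hy hle (hc i (hx.PS_of_zero h))
  · rw [hx.sum, hc N hx.sum]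
  · rcases (hx.nonneg (i+1)).eq_or_lt with h | h
    · have := hx.PS_of_zero h.symm
      rw [this, hc _ this]; simp
    · exact mul_nonneg (sub_nonneg.2 (Real.log_le_log h (hx.anti (Nat.le_succ i))))
        (sub_nonneg.2 (hxy _))

lemma two_point {a b u v : ℝ} (ha : 0 ≤ a) (hau : a ≤ u) (hub : u ≤ b) (h : u + v = a + b) :
    Real.negMulLog a + Real.negMulLog b ≤ Real.negMulLog u + Real.negMulLog v := by
  rcases (hau.trans hub).eq_or_lt with hab | hab
  · obtain rfl : u = a := by linarith
    obtain rfl : v = b := by linarith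
    rfl
  · have hc := Real.concaveOn_negMulLog.2
    have hd : 0 < b - a := by linarith
    have ht : 0 ≤ (b-u)/(b-a) := div_nonneg (by linarith) hd.le
    have ht' : 0 ≤ (u-a)/(b-a) := div_nonneg (by linarith) hd.le
    have h1 : (b-u)/(b-a) + (u-a)/(b-a) = 1 := by field_simp; ring
    have e1 := hc (x := a) ha (y := b) (by simpa using ha.trans hab.le) ht ht' h1
    have e2 := hc (x := a) ha (y := b) (by simpa using ha.trans hab.le) ht' ht (by linarith)
    simp only [smul_eq_mul] at e1 e2
    have u1 : (b-u)/(b-a) * a + (u-a)/(b-a) * b = u := by field_simp; ring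
    have u2 : (u-a)/(b-a) * a + (b-u)/(b-a) * b = v := by
      have : v = a + b - u := by linarith
      rw [this]; field_simp; ring
    rw [u1] at e1; rw [u2] at e2
    have h2 : (u-a)/(b-a) = 1 - (b-u)/(b-a) := by linarith
    rw [h2] at e1 e2
    nlinarith

lemma cross {A B a b : ℝ} (ha : 0 ≤ a) (hb : 0 ≤ b) :
    Real.negMulLog a + Real.negMulLog b ≤
      Real.negMulLog (max (A+a) (B+b) - max A B) + Real.negMulLog (min (A+a) (B+b) - min A B) := by
  rcases le_total A B with h | h <;> rcases le_total (A+a) (B+b) with h' | h' <;>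
    simp only [max_eq_left, max_eq_right, min_eq_left, min_eq_right, h, h']
  · simp [add_comm]
  · rw [add_comm (Real.negMulLog a)]
    exact two_point hb (by linarith) (by linarith) (by ring)
  · exact two_point ha (by linarith) (by linarith) (by ring)
  · simp

lemma PS_diff (F : ℕ → ℝ) (h : F 0 = 0) (k : ℕ) : PS (fun i => F (i+1) - F i) k = F k := by
  rw [PS, sum_range_sub, h, sub_zero]

lemma supermod {N c} (hc : 0 < c) {q a b s : ℕ → ℝ} (hq : Good N c q)
    (ha : Good N c a) (hb : Good N c b)
    (hs : Good N c s) (hqa : ∀ k, PS q k ≤ PS a k) (hqb : ∀ k, PS q k ≤ PS b k)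
    (has : ∀ k, PS a k ≤ PS s k) (hbs : ∀ k, PS b k ≤ PS s k)
    (hv : ∀ i, s (i+1) < s i → PS s (i+1) ≤ max (PS a (i+1)) (PS b (i+1))) :
    PS (fun i => Real.negMulLog (a i)) N + PS (fun i => Real.negMulLog (b i)) N ≤
    PS (fun i => Real.negMulLog (q i)) N + PS (fun i => Real.negMulLog (s i)) N := by
  set W : ℕ → ℝ := fun k => max (PS a k) (PS b k) with hW
  set M : ℕ → ℝ := fun k => min (PS a k) (PS b k) with hM
  have W0 : W 0 = 0 := by simp [hW, PS_zero]
  have M0 : M 0 = 0 := by simp [hM, PS_zero]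
  have Wm : Monotone W := fun i j h => max_le_max (PS_mono ha.nonneg h) (PS_mono hb.nonneg h)
  have Mm : Monotone M := fun i j h => min_le_min (PS_mono ha.nonneg h) (PS_mono hb.nonneg h)
  have Wle : ∀ k, W k ≤ c := fun k => max_le (ha.PS_le k) (hb.PS_le k)
  have Mle : ∀ k, M k ≤ c := fun k => (min_le_left _ _).trans (ha.PS_le k)
  have Ws : ∀ k, W k ≤ PS s k := fun k => max_le (has k) (hbs k)
  have WN : W N = c := by simp [hW, ha.sum, hb.sum]
  have Wc : ∀ k, PS s k = c → W k = c := by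
    intro k
    induction k with
    | zero => intro h; rw [PS_zero] at h; exact absurd h hc.ne
    | succ k ih =>
      intro h
      rcases (hs.nonneg k).eq_or_lt with h0 | h0
      · have := ih (hs.PS_of_zero h0.symm)
        exact le_antisymm (Wle _) (this ▸ Wm (Nat.le_succ k))
      · have h1 : s (k+1) = 0 := eq_zero_of_PS hs.nonneg hs.PS_le h
        exact le_antisymm (Wle _) (h ▸ hv k (by rw [h1]; exact h0))
  have h1 := (schur hq (y := fun i => M (i+1) - M i) (fun i => sub_nonneg.2 (Mm (Nat.le_succ i)))
    (fun k => by rw [PS_diff M M0]; exact Mle k)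
    (fun k => by rw [PS_diff M M0]; exact le_min (hqa k) (hqb k))).1
  have h2 := (key N s (fun i => W (i+1) - W i) hs.nonneg
    (fun i => sub_nonneg.2 (Wm (Nat.le_succ i)))
    (fun i h => by
      have := Wc i (hs.PS_of_zero h)
      have h3 := Wle (i+1)
      have h4 := Wm (Nat.le_succ i)
      simp only [Nat.succ_eq_add_one] at h4
      linarith)
    (by rw [PS_diff W W0, WN, hs.sum])
    (fun i => by
      rw [PS_diff W W0]
      rcases (hs.anti (Nat.le_succ i)).eq_or_lt with h | h
      · simp only [Nat.succ_eq_add_one] at h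
        rw [h]; simp
      · rw [le_antisymm (Ws (i+1)) (hv i h)]; simp)).1
  have h3 : PS (fun i => Real.negMulLog (a i)) N + PS (fun i => Real.negMulLog (b i)) N ≤
      PS (fun i => Real.negMulLog (W (i+1) - W i)) N
      + PS (fun i => Real.negMulLog (M (i+1) - M i)) N := by
    simp only [PS, ← sum_add_distrib]
    refine sum_le_sum fun i _ => ?_
    have := cross (A := PS a i) (B := PS b i) (ha.nonneg i) (hb.nonneg i)
    simpa only [hW, hM, PS_succ] using this
  linarith

/-- extension by zero -/
noncomputable def ext0 {N : ℕ} (p : Fin N → ℝ) (i : ℕ) : ℝ := if h : i < N then p ⟨i, h⟩ else 0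

lemma ext0_fin {N : ℕ} (p : Fin N → ℝ) (i : Fin N) : ext0 p i = p i := by simp [ext0]

lemma PS_ext0 {N : ℕ} (p : Fin N → ℝ) : PS (ext0 p) N = ∑ i, p i := by
  simp [PS, sum_range, ext0]

lemma shannon_ext0 {N : ℕ} (p : Fin N → ℝ) :
    shannonH p = PS (fun i => Real.negMulLog (ext0 p i)) N := by
  simp [PS, sum_range, ext0, shannonH, Real.negMulLog]

lemma good_ext0 {N c} {p : Fin N → ℝ} (hp : p ∈ Pset N c) : Good N c (ext0 p) where
  nonneg i := by
    unfold ext0; split_ifs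
    · exact (hp.1 _).1
    · exact le_rfl
  anti i j h := by
    unfold ext0; split_ifs with h1 h2 h2
    · exact hp.2.1 _ _ h
    · omega
    · exact (hp.1 _).1
    · exact le_rfl
  zero i h := by simp [ext0, h]
  sum := by rw [PS_ext0, hp.2.2]

lemma pSum_eq_s8 {N c} {p : Fin N → ℝ} (hp : p ∈ Pset N c) (k : ℕ) : pSum p k = PS (ext0 p) k := by
  have h1 : sortDesc p = p := by
    have hm : Monotone (p ∘ (Fin.revPerm : Equiv.Perm (Fin N))) := fun i j h =>
      hp.2.1 _ _ (by simpa using h)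
    have := Tuple.comp_sort_eq_comp_iff_monotone.2 hm
    funext i
    have := congrFun this (Fin.rev i)
    simpa [sortDesc] using this.symm
  rw [pSum, h1, PS]
  symm
  have : ∑ i ∈ range k, ext0 p i = ∑ i ∈ (range N).filter (· < k), ext0 p i := by
    have e : (range N).filter (· < k) = (range k).filter (· < N) := by ext; simp [and_comm]
    rw [e, sum_filter]
    refine sum_congr rfl fun i _ => ?_
    unfold ext0; split_ifs <;> rfl
  rw [this, sum_filter, sum_range, sum_filter]
  simp [ext0_fin]

lemma maj_iff_s8 {N c} {p q : Fin N → ℝ} (hp : p ∈ Pset N c) (hq : q ∈ Pset N c) :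
    Maj p q ↔ ∀ k, PS (ext0 p) k ≤ PS (ext0 q) k := by
  simp [Maj, pSum_eq_s8 hp, pSum_eq_s8 hq, hp.2.2, hq.2.2]

lemma eq_of_shannon {N c} {p q : Fin N → ℝ} (hp : p ∈ Pset N c) (hq : q ∈ Pset N c)
    (h : Maj p q) : shannonH q ≤ shannonH p ∧ (shannonH q = shannonH p → q = p) := by
  have := schur (good_ext0 hp) (good_ext0 hq).nonneg (good_ext0 hq).PS_le ((maj_iff_s8 hp hq).1 h)
  rw [shannon_ext0, shannon_ext0]
  refine ⟨this.1, fun he => funext fun i => ?_⟩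
  simpa [ext0_fin] using this.2 he i i.2

/-- The least upper bound touches the maximum of the partial sums at its corners. -/
lemma vertex {N c} {a b s : Fin N → ℝ} (ha : a ∈ Pset N c) (hb : b ∈ Pset N c)
    (hs : s ∈ Pset N c) (has : Maj a s) (hbs : Maj b s)
    (hl : ∀ t ∈ Pset N c, Maj a t → Maj b t → Maj s t) (i : ℕ)
    (hi : ext0 s (i+1) < ext0 s i) :
    PS (ext0 s) (i+1) ≤ max (PS (ext0 a) (i+1)) (PS (ext0 b) (i+1)) := by
  rcases le_or_gt N (i+1) with hN | hN
  · rw [(good_ext0 hs).PS_ge hN, (good_ext0 ha).PS_ge hN]; exact le_max_left _ _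
  by_contra! hlt
  obtain ⟨ε, hε, h1, h2⟩ : ∃ ε > 0, 2 * ε ≤ ext0 s i - ext0 s (i+1) ∧
      ε ≤ PS (ext0 s) (i+1) - max (PS (ext0 a) (i+1)) (PS (ext0 b) (i+1)) :=
    ⟨min ((ext0 s i - ext0 s (i+1))/2)
      (PS (ext0 s) (i+1) - max (PS (ext0 a) (i+1)) (PS (ext0 b) (i+1))),
      lt_min (by linarith) (by linarith),
      by linarith [min_le_left ((ext0 s i - ext0 s (i+1))/2)
          (PS (ext0 s) (i+1) - max (PS (ext0 a) (i+1)) (PS (ext0 b) (i+1)))], min_le_right _ _⟩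
  set x : ℕ → ℝ := fun j => if j = i then ext0 s i - ε else
    if j = i + 1 then ext0 s (i+1) + ε else ext0 s j with hx
  have hPS : ∀ k, PS x k = if k = i + 1 then PS (ext0 s) k - ε else PS (ext0 s) k := by
    intro k
    induction k with
    | zero => simp [PS_zero]
    | succ k ih =>
      rw [PS_succ, PS_succ, ih]
      simp only [hx]
      split_ifs <;> first | omega | (subst_vars; ring)
  have hs0 := good_ext0 hs
  have hanti : ∀ j, x (j+1) ≤ x j := by
    intro j
    have e := hs0.anti (Nat.le_succ j)
    simp only [Nat.succ_eq_add_one] at e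
    simp only [hx]
    split_ifs <;> first | omega | (subst_vars; simp_all; linarith) | (subst_vars; linarith) |
      (simp_all; linarith)
  have hanti := antitone_nat_of_succ_le hanti
  have hle1 : ∀ j, ext0 s j ≤ 1 := by
    intro j; unfold ext0; split_ifs
    · exact (hs.1 _).2
    · exact zero_le_one
  have hxe : ext0 (fun j : Fin N => x j) = x := by
    funext j
    by_cases h : j < N
    · simp [ext0, h]
    · have e1 : j ≠ i := by omega
      have e2 : j ≠ i + 1 := by omega
      simp [ext0, h, hx, e1, e2]
  have ht : (fun j : Fin N => x j) ∈ Pset N c := by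
    refine ⟨fun j => ?_, fun j k h => hanti h, ?_⟩
    · have := hle1 i
      have := hs0.nonneg (i+1)
      have := hle1 j
      have := hs0.nonneg j
      simp only [hx]
      split_ifs <;> constructor <;> linarith
    · rw [← PS_ext0, hxe, hPS, if_neg (by omega), hs0.sum]
  have hup : ∀ p ∈ Pset N c, Maj p s → PS (ext0 p) (i+1) ≤ PS (ext0 s) (i+1) - ε →
      Maj p (fun j : Fin N => x j) := by
    intro p hp hps h
    rw [maj_iff_s8 hp ht, hxe]
    intro k
    rw [hPS]
    split_ifs with hk
    · rw [hk]; exact h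
    · exact (maj_iff_s8 hp hs).1 hps k
  have := hl _ ht (hup a ha has (by linarith [le_max_left (PS (ext0 a) (i+1)) (PS (ext0 b) (i+1))]))
    (hup b hb hbs (by linarith [le_max_right (PS (ext0 a) (i+1)) (PS (ext0 b) (i+1))]))
  rw [maj_iff_s8 hs ht, hxe] at this
  have := this (i+1)
  rw [hPS, if_pos rfl] at this
  linarith

end

/-- `d(p,q) = H(p) + H(q) − 2 H(p ∨ q)` is a metric on the majorization lattice
`P^N`: nonnegative, vanishing exactly on the diagonal, symmetric, and satisfying
the triangle inequality. -/
theorem majorization_lattice_metric (N : ℕ) (c : ℝ) (hc : 0 < c)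
    (join : (Fin N → ℝ) → (Fin N → ℝ) → (Fin N → ℝ))
    (hjoin : ∀ p ∈ Pset N c, ∀ q ∈ Pset N c,
      join p q ∈ Pset N c ∧ Maj p (join p q) ∧ Maj q (join p q) ∧
        ∀ t ∈ Pset N c, Maj p t → Maj q t → Maj (join p q) t)
    (p q r : Fin N → ℝ)
    (hp : p ∈ Pset N c) (hq : q ∈ Pset N c) (hr : r ∈ Pset N c) :
    let d := fun a b => shannonH a + shannonH b - 2 * shannonH (join a b)
    0 ≤ d p q ∧ (d p q = 0 ↔ p = q) ∧ d p q = d q p ∧ d p r ≤ d p q + d q r := by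
  intro d
  have trans : ∀ {x y z : Fin N → ℝ}, Maj x y → Maj y z → Maj x z := fun h h' =>
    ⟨fun k => (h.1 k).trans (h'.1 k), h.2.trans h'.2⟩
  obtain ⟨j1, j2, j3, j4⟩ := hjoin p hp q hq
  obtain ⟨k1, k2, k3, k4⟩ := hjoin q hq r hr
  obtain ⟨l1, l2, l3, l4⟩ := hjoin p hp r hr
  obtain ⟨m1, m2, m3, m4⟩ := hjoin q hq p hp
  obtain ⟨e1, e2, e3, e4⟩ := hjoin _ j1 _ k1
  have hpj := eq_of_shannon hp j1 j2
  have hqj := eq_of_shannon hq j1 j3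
  have hd : d p q = shannonH p + shannonH q - 2 * shannonH (join p q) := rfl
  refine ⟨by rw [hd]; linarith [hpj.1, hqj.1], ⟨fun h => ?_, fun h => ?_⟩, ?_, ?_⟩
  · rw [hd] at h
    exact (hpj.2 (by linarith [hpj.1, hqj.1])).symm.trans (hqj.2 (by linarith [hpj.1, hqj.1]))
  · subst h
    have h1 : Maj p p := ⟨fun _ => le_rfl, rfl⟩
    have h2 := (eq_of_shannon j1 hp (j4 p hp h1 h1)).1
    rw [hd]; linarith [hpj.1]
  · have h1 := (eq_of_shannon j1 m1 (j4 _ m1 m3 m2)).1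
    have h2 := (eq_of_shannon m1 j1 (m4 _ j1 j3 j2)).1
    change shannonH p + shannonH q - 2 * shannonH (join p q) =
      shannonH q + shannonH p - 2 * shannonH (join q p)
    linarith
  · have h1 := supermod hc (good_ext0 hq) (good_ext0 j1) (good_ext0 k1) (good_ext0 e1)
      ((maj_iff_s8 hq j1).1 j3) ((maj_iff_s8 hq k1).1 k2) ((maj_iff_s8 j1 e1).1 e2) ((maj_iff_s8 k1 e1).1 e3)
      (vertex j1 k1 e1 e2 e3 e4)
    simp only [← shannon_ext0] at h1
    have h2 := (eq_of_shannon l1 e1 (l4 _ e1 (trans j2 e2) (trans k3 e3))).1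
    change shannonH p + shannonH r - 2 * shannonH (join p r) ≤
      (shannonH p + shannonH q - 2 * shannonH (join p q)) +
      (shannonH q + shannonH r - 2 * shannonH (join q r))
    linarith
end

section
/- Flattening lemma: Let b = (b_1,…,b_N) be a nonnegative vector with Σ_r b_r = c and entries in [0,1]. Suppose there is an index in {2,…,N} with b at that index strictly greater than its predecessor, and let j be the smallest such index. Let i be the greatest index in {1,…,j−1} such that b_{i−1} ≥ a, where a := (Σ_{r=i}^j b_r)/(j−i+1) (with the convention b_0 = +∞, so such i exists). Define μ ∈ ℝ^N by μ_r = a for i ≤ r ≤ j and μ_r = b_r otherwise. Then: (1) μ_{r−1} ≥ μ_r for all r ∈ {2,…,j}; (2) Σ_{r=1}^k μ_r ≥ Σ_{r=1}^k b_r for all k ∈ {1,…,N}; and (3) for every t ∈ P^N (total sum c) satisfying Σ_{r=1}^k t_r ≥ Σ_{r=1}^k b_r for all k, one also has Σ_{r=1}^k t_r ≥ Σ_{r=1}^k μ_r for all k. -/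
theorem flat_split (f : ℕ → ℝ) (m n : ℕ) (h : m ≤ n) :
    ∑ r ∈ Finset.Icc (m + 1) n, f r =
      ∑ r ∈ Finset.Icc 1 n, f r - ∑ r ∈ Finset.Icc 1 m, f r := by
  induction n, h using Nat.le_induction with
  | base => simp
  | succ n hn ih =>
    rw [Finset.sum_Icc_succ_top (by omega), Finset.sum_Icc_succ_top (by omega), ih]
    ring

theorem flat_mono (f g : ℕ → ℝ) (m n : ℕ) (h : m ≤ n)
    (hfg : ∀ r, m + 1 ≤ r → r ≤ n → f r ≤ g r) :
    ∑ r ∈ Finset.Icc 1 n, f r - ∑ r ∈ Finset.Icc 1 m, f r ≤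
      ∑ r ∈ Finset.Icc 1 n, g r - ∑ r ∈ Finset.Icc 1 m, g r := by
  rw [← flat_split f m n h, ← flat_split g m n h]
  apply Finset.sum_le_sum
  intro r hr
  rw [Finset.mem_Icc] at hr
  exact hfg r hr.1 hr.2

theorem flat_anti (f : ℕ → ℝ) (n p q : ℕ) (hp : 1 ≤ p) (hpq : p ≤ q) (hq : q ≤ n)
    (h : ∀ r, 2 ≤ r → r ≤ n → f r ≤ f (r - 1)) : f q ≤ f p := by
  induction q, hpq using Nat.le_induction with
  | base => exact le_rfl
  | succ q hq' ih =>
    have := h (q + 1) (by omega) hq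
    simp only [Nat.add_sub_cancel] at this
    exact this.trans (ih (by omega))

/-- Flattening lemma (Lemma 3 of Bondar et al. as used for the majorization
lattice).  The vector `b` is indexed `b 1, …, b N`; `j` is the smallest index in
`{2,…,N}` with `b j > b (j−1)`; `i` is the greatest index in `{1,…,j−1}` such that
`b (i−1) ≥ a` where `a = (Σ_{r=i}^j b r)/(j−i+1)` (with the convention
`b 0 = +∞`, expressed by letting `i = 1` qualify automatically); and `μ` replaces
the entries `b i, …, b j` by their average `a`. -/
theorem flattening_lemma (N : ℕ) (c : ℝ) (hc : 0 < c) (b : ℕ → ℝ)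
    (hb01 : ∀ r, 1 ≤ r → r ≤ N → 0 ≤ b r ∧ b r ≤ 1)
    (hbsum : ∑ r ∈ Finset.Icc 1 N, b r = c)
    (j : ℕ) (hj2 : 2 ≤ j) (hjN : j ≤ N) (hjup : b (j - 1) < b j)
    (hjmin : ∀ j', 2 ≤ j' → j' < j → b j' ≤ b (j' - 1))
    (A : ℕ → ℝ)
    (hA : ∀ i', A i' = (∑ r ∈ Finset.Icc i' j, b r) / ((j - i' + 1 : ℕ) : ℝ))
    (i : ℕ) (hi1 : 1 ≤ i) (hij : i ≤ j - 1)
    (hicond : i = 1 ∨ A i ≤ b (i - 1))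
    (himax : ∀ i', i < i' → i' ≤ j - 1 → b (i' - 1) < A i')
    (μ : ℕ → ℝ)
    (hμ : ∀ r, μ r = if i ≤ r ∧ r ≤ j then A i else b r) :
    (∀ r, 2 ≤ r → r ≤ j → μ r ≤ μ (r - 1)) ∧
    (∀ k, 1 ≤ k → k ≤ N →
      ∑ r ∈ Finset.Icc 1 k, b r ≤ ∑ r ∈ Finset.Icc 1 k, μ r) ∧
    (∀ t : ℕ → ℝ,
      (∀ r, 1 ≤ r → r ≤ N → 0 ≤ t r ∧ t r ≤ 1) →
      (∀ r, 2 ≤ r → r ≤ N → t r ≤ t (r - 1)) →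
      (∑ r ∈ Finset.Icc 1 N, t r = c) →
      (∀ k, 1 ≤ k → k ≤ N →
        ∑ r ∈ Finset.Icc 1 k, b r ≤ ∑ r ∈ Finset.Icc 1 k, t r) →
      ∀ k, 1 ≤ k → k ≤ N →
        ∑ r ∈ Finset.Icc 1 k, μ r ≤ ∑ r ∈ Finset.Icc 1 k, t r) := by
  have hjm : ∀ r, 2 ≤ r → r ≤ j - 1 → b r ≤ b (r - 1) :=
    fun r h1 h2 => hjmin r h1 (by omega)
  have hmid : ∀ r, i ≤ r → r ≤ j → μ r = A i := fun r h1 h2 => by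
    rw [hμ, if_pos ⟨h1, h2⟩]
  have hout : ∀ r, ¬ (i ≤ r ∧ r ≤ j) → μ r = b r := fun r h => by
    rw [hμ, if_neg h]
  have hAmul : ∀ p, p ≤ j → A p * ((j : ℝ) - p + 1) = ∑ r ∈ Finset.Icc p j, b r := by
    intro p hp
    have e : ((j - p + 1 : ℕ) : ℝ) = (j : ℝ) - p + 1 := by
      rw [Nat.cast_add, Nat.cast_sub hp, Nat.cast_one]
    have h0 : (j : ℝ) - p + 1 ≠ 0 := by rw [← e]; positivity
    rw [hA, e, div_mul_cancel₀ _ h0]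
  have hbi : b i ≤ A i := by
    have h1 := hAmul i (by omega)
    have h2 := hAmul (i + 1) (by omega)
    rw [← Finset.add_sum_Ioc_eq_sum_Icc (by omega)] at h1
    have e : Finset.Ioc i j = Finset.Icc (i + 1) j := by
      ext x; simp only [Finset.mem_Ioc, Finset.mem_Icc]; omega
    rw [e, ← h2] at h1
    have h3 : b i < A (i + 1) := by
      rcases Nat.lt_or_ge i (j - 1) with h | h
      · have := himax (i + 1) (by omega) (by omega)
        simpa using this
      · have e1 : i = j - 1 := by omega
        have e2 : i + 1 = j := by omega
        have : A (i + 1) = b j := by rw [e2, hA]; simp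
        rw [this, e1]; exact hjup
    have hij' : (i : ℝ) + 1 ≤ j := by exact_mod_cast (by omega : i + 1 ≤ j)
    push_cast at h1
    by_contra hcon
    push Not at hcon
    nlinarith
  have hbA : ∀ r, i ≤ r → r ≤ j - 1 → b r ≤ A i := fun r h1 h2 =>
    (flat_anti b (j - 1) i r hi1 h1 h2 hjm).trans hbi
  have hlow : ∀ k, k < i → ∑ r ∈ Finset.Icc 1 k, μ r = ∑ r ∈ Finset.Icc 1 k, b r := by
    intro k hk
    apply Finset.sum_congr rfl
    intro r hr
    rw [Finset.mem_Icc] at hr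
    exact hout r (by omega)
  obtain ⟨m, rfl⟩ : ∃ m, i = m + 1 := ⟨i - 1, by omega⟩
  have hlm := hlow m (by omega)
  have hSj : ∑ r ∈ Finset.Icc 1 j, μ r = ∑ r ∈ Finset.Icc 1 j, b r := by
    have h1 := flat_split μ m j (by omega)
    have h2 := flat_split b m j (by omega)
    have h3 := hAmul (m + 1) (by omega)
    have h4 : ∑ r ∈ Finset.Icc (m + 1) j, μ r = A (m + 1) * ((j : ℝ) - (m + 1 : ℕ) + 1) := by
      rw [Finset.sum_congr rfl (g := fun _ => A (m + 1))
        (fun r hr => by rw [Finset.mem_Icc] at hr; exact hmid r hr.1 hr.2)]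
      rw [Finset.sum_const, Nat.card_Icc, nsmul_eq_mul, Nat.cast_sub (by omega)]
      push_cast
      ring
    linarith
  have hhigh : ∀ k, j ≤ k → ∑ r ∈ Finset.Icc 1 k, μ r = ∑ r ∈ Finset.Icc 1 k, b r := by
    intro k hk
    have h1 := flat_mono μ b j k hk (fun r h1 _ => (hout r (by omega)).le)
    have h2 := flat_mono b μ j k hk (fun r h1 _ => (hout r (by omega)).ge)
    linarith
  refine ⟨?_, ?_, ?_⟩
  · intro r h2 hr
    rcases Nat.lt_trichotomy r (m + 1) with h | h | h
    · rw [hout r (by omega), hout (r - 1) (by omega)]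
      exact hjmin r h2 (by omega)
    · subst h
      rw [hmid _ le_rfl (by omega), hout _ (by omega)]
      rcases hicond with h | h
      · omega
      · exact h
    · rw [hmid _ (by omega) hr, hmid _ (by omega) (by omega)]
  · intro k h1 hk
    rcases Nat.lt_or_ge k (m + 1) with h | h
    · exact (hlow k h).ge
    rcases Nat.lt_or_ge k j with h' | h'
    · have := flat_mono b μ m k (by omega) (fun r h1 h2 => by
        rw [hmid r h1 (by omega)]; exact hbA r h1 (by omega))
      linarith
    · exact (hhigh k h').ge
  · intro t _ htanti _ htb k h1 hk
    rcases Nat.lt_or_ge k (m + 1) with h | h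
    · rw [hlow k h]; exact htb k h1 hk
    rcases Nat.lt_or_ge k j with h' | h'
    · rcases le_total (A (m + 1)) (t k) with ht | ht
      · have h3 := flat_mono μ t m k (by omega) (fun r h1 h2 => by
          rw [hmid r h1 (by omega)]
          exact ht.trans (flat_anti t N r k (by omega) h2 hk htanti))
        have h4 : ∑ r ∈ Finset.Icc 1 m, b r ≤ ∑ r ∈ Finset.Icc 1 m, t r := by
          rcases Nat.eq_zero_or_pos m with h0 | h0
          · subst h0; simp
          · exact htb m h0 (by omega)
        linarith
      · have h3 := flat_mono t μ k j (by omega) (fun r h1 h2 => by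
          rw [hmid r (by omega) h2]
          exact (flat_anti t N k r (by omega) (by omega) (by omega) htanti).trans ht)
        have h4 := htb j (by omega) hjN
        linarith
    · rw [hhigh k h']; exact htb k h1 hk
end
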